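/- Let (X,d_X) and (Y,d_Y) be compact metric spaces, let f : X → X, g : Y → Y and π : X → Y be continuous maps with π surjective and π ∘ f = g ∘ π. Then h(f) ≤ h(g) + sup_{y∈Y} h(f, π⁻¹({y})), where h(f) and h(g) denote the topological entropies of f and g, and h(f, π⁻¹({y})) denotes the topological entropy of f on the compact fiber π⁻¹({y}). -/

import Mathlib

open Set Filter

/-- A finite set `F` `(n,ε)`-spans `K` for the map `f`. -/
def Spans {X : Type*} [MetricSpace X] (f : X → X) (K : Set X) (F : Finset X)
    (n : ℕ) (ε : ℝ) : Prop :=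
  ∀ y ∈ K, ∃ x ∈ F, ∀ i < n, dist (f^[i] x) (f^[i] y) < ε

/-- `N(n,ε,K)`: the minimal cardinality of an `(n,ε)`-spanning set of `K`. -/
noncomputable def spanNum {X : Type*} [MetricSpace X] (f : X → X) (K : Set X)
    (n : ℕ) (ε : ℝ) : ℕ :=
  sInf {m : ℕ | ∃ F : Finset X, Spans f K F n ε ∧ F.card = m}

/-- The topological entropy of `f` on the set `K`:
`lim_{ε→0} limsup_n (1/n) log N(n,ε,K)`; since `N(n,ε,K)` is antitone in `ε`
the limit as `ε → 0` equals the supremum over `ε > 0`. -/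
noncomputable def entropyOn {X : Type*} [MetricSpace X] (f : X → X) (K : Set X) : EReal :=
  ⨆ (ε : ℝ) (_ : 0 < ε),
    Filter.atTop.limsup fun n : ℕ => ((Real.log (spanNum f K n ε) / n : ℝ) : EReal)

universe u

theorem isOpen_setOf_forall_dist_iterate_lt {X : Type*} [MetricSpace X] {f : X → X}
    (hf : Continuous f) (x : X) (n : ℕ) (ε : ℝ) :
    IsOpen {y | ∀ i < n, dist (f^[i] x) (f^[i] y) < ε} := by
  have h : {y | ∀ i < n, dist (f^[i] x) (f^[i] y) < ε} =
      ⋂ i ∈ Finset.range n, {y | dist (f^[i] x) (f^[i] y) < ε} := by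
    ext y; simp
  rw [h]
  exact isOpen_biInter_finset fun i _ =>
    isOpen_lt (continuous_const.dist (hf.iterate i)) continuous_const

theorem exists_spans {X : Type*} [MetricSpace X] [CompactSpace X] {f : X → X}
    (hf : Continuous f) (K : Set X) (n : ℕ) {ε : ℝ} (hε : 0 < ε) :
    ∃ F : Finset X, Spans f K F n ε := by
  obtain ⟨F, -, hF⟩ := (isCompact_univ (X := X)).elim_nhds_subcover
    (fun x => {y | ∀ i < n, dist (f^[i] x) (f^[i] y) < ε})
    (fun x _ => (isOpen_setOf_forall_dist_iterate_lt hf x n ε).mem_nhds (by simp [hε]))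
  refine ⟨F, fun y _ => ?_⟩
  simpa using hF (mem_univ y)

theorem exists_spans_card_eq_spanNum {X : Type*} [MetricSpace X] [CompactSpace X] {f : X → X}
    (hf : Continuous f) (K : Set X) (n : ℕ) {ε : ℝ} (hε : 0 < ε) :
    ∃ F : Finset X, Spans f K F n ε ∧ F.card = spanNum f K n ε := by
  obtain ⟨F, hF⟩ := exists_spans hf K n hε
  exact Nat.sInf_mem (s := {m : ℕ | ∃ F : Finset X, Spans f K F n ε ∧ F.card = m}) ⟨_, F, hF, rfl⟩

theorem spanNum_le_card {X : Type*} [MetricSpace X] {f : X → X} {K : Set X} {n : ℕ} {ε : ℝ}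
    {F : Finset X} (hF : Spans f K F n ε) : spanNum f K n ε ≤ F.card :=
  Nat.sInf_le ⟨F, hF, rfl⟩

theorem limsup_le_entropyOn {X : Type*} [MetricSpace X] (f : X → X) (K : Set X) {ε : ℝ}
    (hε : 0 < ε) :
    atTop.limsup (fun n : ℕ => ((Real.log (spanNum f K n ε) / n : ℝ) : EReal))
      ≤ entropyOn f K :=
  le_iSup₂ (f := fun (ε : ℝ) (_ : 0 < ε) =>
    atTop.limsup fun n : ℕ => ((Real.log (spanNum f K n ε) / n : ℝ) : EReal)) ε hε

theorem limsup_log_spanNum_nonneg {X : Type*} [MetricSpace X] (f : X → X) (K : Set X) (ε : ℝ) :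
    0 ≤ atTop.limsup (fun n : ℕ => ((Real.log (spanNum f K n ε) / n : ℝ) : EReal)) := by
  refine le_limsup_of_frequently_le (Frequently.of_forall fun n => ?_)
  exact EReal.coe_nonneg.2 (div_nonneg (Real.log_natCast_nonneg _) n.cast_nonneg)

theorem entropyOn_nonneg {X : Type*} [MetricSpace X] (f : X → X) (K : Set X) :
    0 ≤ entropyOn f K :=
  (limsup_log_spanNum_nonneg f K 1).trans (limsup_le_entropyOn f K one_pos)

/-- If the entropy of `f` on `K` is less than `b`, then `K` has spanning sets of size at most
`exp (b m)` for some `m ≥ 1`. -/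
theorem exists_spans_card_le_exp {X : Type*} [MetricSpace X] [CompactSpace X] {f : X → X}
    (hf : Continuous f) {K : Set X} {b ε : ℝ} (hε : 0 < ε) (hb : entropyOn f K < b) :
    ∃ m : ℕ, 1 ≤ m ∧ ∃ F : Finset X, Spans f K F m ε ∧ (F.card : ℝ) ≤ Real.exp (b * m) := by
  have h := eventually_lt_of_limsup_lt ((limsup_le_entropyOn f K hε).trans_lt hb)
  obtain ⟨m, hm, hm1⟩ := (h.and (eventually_ge_atTop 1)).exists
  obtain ⟨F, hF, hcard⟩ := exists_spans_card_eq_spanNum hf K m hε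
  refine ⟨m, hm1, F, hF, ?_⟩
  have hm0 : (0 : ℝ) < m := by exact_mod_cast hm1
  rw [EReal.coe_lt_coe_iff, div_lt_iff₀ hm0] at hm
  rw [hcard]
  rcases Nat.eq_zero_or_pos (spanNum f K m ε) with h0 | h0
  · rw [h0]; simpa using (Real.exp_pos _).le
  · exact (Real.log_le_iff_le_exp (by exact_mod_cast h0)).1 hm.le

/-- Suppose every `δ`-ball of `Y` lifts to a set spanned, for some time `1 ≤ m ≤ M`, by at most
`exp (b m)` points. Then the lift of every dynamical `δ`-ball of length `n` is covered by at most
`exp (b (n + M))` sets of dynamical diameter less than `2ε`. -/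
theorem exists_cover_preimage_dynamical_ball {X : Type u} {Y : Type*} [MetricSpace X]
    [MetricSpace Y] {f : X → X} {g : Y → Y} {π : X → Y} (hcomm : Function.Semiconj π f g)
    {δ ε b : ℝ} (hb : 0 ≤ b) {M : ℕ}
    (H : ∀ y : Y, ∃ m : ℕ, 1 ≤ m ∧ m ≤ M ∧ ∃ E : Finset X, (E.card : ℝ) ≤ Real.exp (b * m) ∧
      ∀ x, dist y (π x) < δ → ∃ z ∈ E, ∀ i < m, dist (f^[i] z) (f^[i] x) < ε)
    (n : ℕ) (y : Y) :
    ∃ (ι : Type u) (_ : Fintype ι) (S : ι → Set X),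
      (Fintype.card ι : ℝ) ≤ Real.exp (b * (n + M)) ∧
      (∀ x, (∀ i < n, dist (g^[i] y) (g^[i] (π x)) < δ) → ∃ j, x ∈ S j) ∧
      ∀ j, ∀ x ∈ S j, ∀ x' ∈ S j, ∀ i < n, dist (f^[i] x) (f^[i] x') < 2 * ε := by
  induction n using Nat.strong_induction_on generalizing y with
  | _ n ih =>
  rcases Nat.eq_zero_or_pos n with rfl | hn
  · refine ⟨PUnit, inferInstance, fun _ => univ, ?_, by simp, by simp⟩
    simpa using Real.one_le_exp (by positivity)
  obtain ⟨m, hm1, hmM, E, hEcard, hE⟩ := H y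
  have key : ∀ z : X, ∀ x x' : X, (∀ i < m, dist (f^[i] z) (f^[i] x) < ε) →
      (∀ i < m, dist (f^[i] z) (f^[i] x') < ε) →
      ∀ i < m, dist (f^[i] x) (f^[i] x') < 2 * ε := by
    intro z x x' hx hx' i hi
    have := dist_triangle_left (f^[i] x) (f^[i] x') (f^[i] z)
    linarith [hx i hi, hx' i hi]
  rcases le_total n m with hnm | hmn
  · refine ⟨E, inferInstance, fun z => {x | ∀ i < m, dist (f^[i] z) (f^[i] x) < ε}, ?_, ?_, ?_⟩
    · rw [Fintype.card_coe]
      refine hEcard.trans (Real.exp_le_exp.2 (mul_le_mul_of_nonneg_left ?_ hb))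
      exact_mod_cast hmM.trans (Nat.le_add_left _ _)
    · intro x hx
      obtain ⟨z, hz, h⟩ := hE x (hx 0 hn)
      exact ⟨⟨z, hz⟩, h⟩
    · exact fun z x hx x' hx' i hi => key z x x' hx hx' i (hi.trans_le hnm)
  · obtain ⟨ι, _, S, hcard, hcov, hdiam⟩ := ih (n - m) (by omega) (g^[m] y)
    refine ⟨E × ι, inferInstance,
      fun p => {x | (∀ i < m, dist (f^[i] p.1) (f^[i] x) < ε) ∧ f^[m] x ∈ S p.2}, ?_, ?_, ?_⟩
    · rw [Fintype.card_prod, Fintype.card_coe, Nat.cast_mul]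
      refine (mul_le_mul hEcard hcard (Nat.cast_nonneg _) (Real.exp_pos _).le).trans ?_
      rw [← Real.exp_add, Nat.cast_sub hmn]
      exact (congrArg Real.exp (by ring)).le
    · intro x hx
      obtain ⟨z, hz, h⟩ := hE x (hx 0 hn)
      obtain ⟨j, hj⟩ := hcov (f^[m] x) fun i hi => by
        have := hx (i + m) (by omega)
        rwa [Function.iterate_add_apply, Function.iterate_add_apply,
          ← (hcomm.iterate_right m).eq x] at this
      exact ⟨(⟨z, hz⟩, j), h, hj⟩
    · rintro ⟨z, j⟩ x ⟨hx, hxS⟩ x' ⟨hx', hxS'⟩ i hi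
      rcases lt_or_ge i m with him | him
      · exact key z x x' hx hx' i him
      · have := hdiam j _ hxS _ hxS' (i - m) (by omega)
        rwa [← Function.iterate_add_apply, ← Function.iterate_add_apply,
          Nat.sub_add_cancel him] at this

/-- A spanning set of the base together with covers of the lifts of its dynamical balls bounds the
spanning number upstairs. -/
theorem spanNum_le_of_cover {X : Type u} {Y : Type*} [MetricSpace X] [Nonempty X]
    [MetricSpace Y] [CompactSpace Y] {f : X → X} {g : Y → Y} (hg : Continuous g) {π : X → Y}
    {δ η C : ℝ} (hδ : 0 < δ) {n : ℕ}
    (H : ∀ y : Y, ∃ (ι : Type u) (_ : Fintype ι) (S : ι → Set X), (Fintype.card ι : ℝ) ≤ C ∧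
      (∀ x, (∀ i < n, dist (g^[i] y) (g^[i] (π x)) < δ) → ∃ j, x ∈ S j) ∧
      ∀ j, ∀ x ∈ S j, ∀ x' ∈ S j, ∀ i < n, dist (f^[i] x) (f^[i] x') < η) :
    (spanNum f univ n η : ℝ) ≤ spanNum g univ n δ * C := by
  classical
  obtain ⟨F, hF, hFcard⟩ := exists_spans_card_eq_spanNum hg univ n hδ
  choose ι _ S hcard hcov hdiam using H
  let G : Finset X := F.biUnion fun y =>
    Finset.univ.image fun j : ι y => Classical.epsilon fun x => x ∈ S y j
  have hG : Spans f univ G n η := by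
    intro x _
    obtain ⟨y, hy, hyx⟩ := hF (π x) (mem_univ _)
    obtain ⟨j, hj⟩ := hcov y x hyx
    refine ⟨Classical.epsilon fun x => x ∈ S y j, ?_, ?_⟩
    · exact Finset.mem_biUnion.2 ⟨y, hy, Finset.mem_image_of_mem _ (Finset.mem_univ j)⟩
    · exact hdiam y j _ (Classical.epsilon_spec (p := fun x => x ∈ S y j) ⟨x, hj⟩) x hj
  calc (spanNum f univ n η : ℝ) ≤ G.card := by exact_mod_cast spanNum_le_card hG
    _ ≤ ∑ y ∈ F, (Fintype.card (ι y) : ℝ) := by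
      exact_mod_cast Finset.card_biUnion_le.trans
        (Finset.sum_le_sum fun y _ => Finset.card_image_le)
    _ ≤ ∑ _y ∈ F, C := Finset.sum_le_sum fun y _ => hcard y
    _ = spanNum g univ n δ * C := by rw [Finset.sum_const, nsmul_eq_mul, hFcard]

/-- A continuous map out of a compact space sees open neighbourhoods of its fibers uniformly:
the data attached to fibers can be chosen from a finite set on balls of a fixed radius. -/
theorem exists_uniform_fiber_spans {X Y : Type*} [MetricSpace X] [CompactSpace X]
    [MetricSpace Y] [CompactSpace Y] {f : X → X} {π : X → Y} (hf : Continuous f)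
    (hπ : Continuous π) {b ε : ℝ} (hε : 0 < ε) (hb : ∀ y, entropyOn f (π ⁻¹' {y}) < b) :
    ∃ δ > 0, ∃ M : ℕ, ∀ y : Y, ∃ m : ℕ, 1 ≤ m ∧ m ≤ M ∧
      ∃ E : Finset X, (E.card : ℝ) ≤ Real.exp (b * m) ∧
        ∀ x, dist y (π x) < δ → ∃ z ∈ E, ∀ i < m, dist (f^[i] z) (f^[i] x) < ε := by
  choose m hm E hE hEcard using fun y => exists_spans_card_le_exp hf hε (hb y)
  let U : Y → Set X := fun y => ⋃ z ∈ E y, {x | ∀ i < m y, dist (f^[i] z) (f^[i] x) < ε}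
  have hU : ∀ y, IsOpen (U y) := fun y =>
    isOpen_biUnion fun z _ => isOpen_setOf_forall_dist_iterate_lt hf z (m y) ε
  let W : Y → Set Y := fun y => (π '' (U y)ᶜ)ᶜ
  have hW : ∀ y, IsOpen (W y) := fun y =>
    (hπ.isClosedMap _ (hU y).isClosed_compl).isOpen_compl
  have hyW : ∀ y, y ∈ W y := by
    rintro y ⟨x, hx, rfl⟩
    exact hx (by simpa [U] using hE (π x) x rfl)
  obtain ⟨t, -, ht⟩ := (isCompact_univ (X := Y)).elim_nhds_subcover W
    fun y _ => (hW y).mem_nhds (hyW y)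
  obtain ⟨δ, hδ, hball⟩ := lebesgue_number_lemma_of_metric (c := fun y : t => W y)
    isCompact_univ (fun y => hW y) (by rwa [iUnion_subtype])
  refine ⟨δ, hδ, t.sup m, fun y => ?_⟩
  obtain ⟨⟨c, hc⟩, hcy⟩ := hball y (mem_univ y)
  refine ⟨m c, hm c, Finset.le_sup hc, E c, hEcard c, fun x hx => ?_⟩
  have hxU : x ∈ U c := by
    by_contra hxU
    exact hcy (Metric.mem_ball'.2 hx) ⟨x, hxU, rfl⟩
  simpa [U] using hxU

theorem limsup_le_limsup_add_of_spanNum_le {X Y : Type*} [MetricSpace X] [MetricSpace Y]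
    {f : X → X} {g : Y → Y} {K : Set X} {L : Set Y} {η δ b c : ℝ} (hb : 0 ≤ b) (hc : 0 ≤ c)
    (h : ∀ n : ℕ, (spanNum f K n η : ℝ) ≤ spanNum g L n δ * Real.exp (b * (n + c))) :
    atTop.limsup (fun n : ℕ => ((Real.log (spanNum f K n η) / n : ℝ) : EReal)) ≤
      atTop.limsup (fun n : ℕ => ((Real.log (spanNum g L n δ) / n : ℝ) : EReal)) + b := by
  have hlog : ∀ n : ℕ, Real.log (spanNum f K n η) ≤
      Real.log (spanNum g L n δ) + b * (n + c) := by
    intro n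
    rcases Nat.eq_zero_or_pos (spanNum f K n η) with h0 | h0
    · rw [h0, Nat.cast_zero, Real.log_zero]
      exact add_nonneg (Real.log_natCast_nonneg _) (by positivity)
    · have h0' : (0 : ℝ) < spanNum f K n η := by exact_mod_cast h0
      have hg0 : (0 : ℝ) < spanNum g L n δ :=
        pos_of_mul_pos_left (h0'.trans_le (h n)) (Real.exp_pos _).le
      have := Real.log_le_log h0' (h n)
      rwa [Real.log_mul hg0.ne' (Real.exp_pos _).ne', Real.log_exp] at this
  have hlim : Tendsto (fun n : ℕ => ((b + b * c / n : ℝ) : EReal)) atTop (nhds (b : EReal)) := by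
    refine (continuous_coe_real_ereal.tendsto b).comp ?_
    simpa using tendsto_const_nhds.add (tendsto_const_div_atTop_nhds_zero_nat (b * c))
  rw [← hlim.limsup_eq]
  refine le_trans (limsup_le_limsup ?_) (EReal.limsup_add_le ?_ ?_)
  · filter_upwards [eventually_gt_atTop 0] with n hn
    have hn' : (0 : ℝ) < n := by exact_mod_cast hn
    simp only [Pi.add_apply]
    rw [← EReal.coe_add, EReal.coe_le_coe_iff]
    calc _ ≤ (Real.log (spanNum g L n δ) + b * (n + c)) / n := by gcongr; exact hlog n
      _ = _ := by field_simp
  · rw [hlim.limsup_eq]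
    exact Or.inr (EReal.coe_ne_top b)
  · rw [hlim.limsup_eq]
    exact Or.inr (EReal.coe_ne_bot b)

/-- Bowen's fibered entropy inequality: if `π` semi-conjugates `f : X → X` with
`g : Y → Y` (`π` continuous surjective, `π ∘ f = g ∘ π`, all spaces compact metric),
then `h(f) ≤ h(g) + sup_y h(f, π⁻¹({y}))`. -/
theorem stmt6 {X Y : Type*} [MetricSpace X] [CompactSpace X] [Nonempty X]
    [MetricSpace Y] [CompactSpace Y]
    (f : X → X) (g : Y → Y) (π : X → Y)
    (hf : Continuous f) (hg : Continuous g) (hπ : Continuous π)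
    (hsurj : Function.Surjective π) (hcomm : π ∘ f = g ∘ π) :
    entropyOn f Set.univ ≤ entropyOn g Set.univ + ⨆ y : Y, entropyOn f (π ⁻¹' {y}) := by
  have : Nonempty Y := Nonempty.map π ‹_›
  have ha0 : 0 ≤ ⨆ y : Y, entropyOn f (π ⁻¹' {y}) :=
    (entropyOn_nonneg f _).trans (le_iSup (fun y : Y => entropyOn f (π ⁻¹' {y}))
      (Classical.arbitrary Y))
  have hg0 := entropyOn_nonneg g univ
  refine EReal.le_add_of_forall_gt (Or.inl (EReal.bot_lt_zero.trans_le hg0).ne')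
    (Or.inr (EReal.bot_lt_zero.trans_le ha0).ne') fun a' ha' b' hb' => ?_
  induction b' with
  | bot => exact absurd hb' not_lt_bot
  | top => rw [EReal.add_top_of_ne_bot (bot_le.trans_lt ha').ne']; exact le_top
  | coe b =>
    have hb0 : 0 ≤ b := EReal.coe_nonneg.1 (ha0.trans hb'.le)
    refine iSup₂_le fun ε hε => ?_
    obtain ⟨δ, hδ, M, H⟩ := exists_uniform_fiber_spans hf hπ (half_pos hε) fun y =>
      (le_iSup (fun y : Y => entropyOn f (π ⁻¹' {y})) y).trans_lt hb'
    have hle : ∀ n : ℕ, (spanNum f univ n ε : ℝ) ≤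
        spanNum g univ n δ * Real.exp (b * (n + M)) := fun n => by
      have := spanNum_le_of_cover hg hδ
        (exists_cover_preimage_dynamical_ball (Function.semiconj_iff_comp_eq.2 hcomm) hb0 H n)
      rwa [mul_div_cancel₀ ε two_ne_zero] at this
    refine (limsup_le_limsup_add_of_spanNum_le hb0 M.cast_nonneg hle).trans ?_
    gcongr
    exact (limsup_le_entropyOn g univ hδ).trans ha'.le
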